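/- For every countable pruned tree T, the quasi-difference sets of [T] are exactly the sets in the difference hierarchy: 𝒟([T]) = ∪_{0<θ<ω₁} D_θ([T]). -/

import Mathlib

/-! Basic setup: trees of finite sequences, their branches, the topology on the set of
branches, the Hausdorff difference hierarchy, quasi-difference sets, and infinite
games in extensive form. -/

/-- `T` is a tree over `α`: a set of finite sequences closed under taking prefixes. -/
def IsTree {α : Type*} (T : Set (List α)) : Prop :=
  ∀ ⦃γ δ : List α⦄, γ <+: δ → δ ∈ T → γ ∈ T

/-- `succ(T, γ)`: the nodes of `T` extending `γ` and of length `|γ| + 1`. -/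
def treeSucc {α : Type*} (T : Set (List α)) (γ : List α) : Set (List α) :=
  {δ | δ ∈ T ∧ γ <+: δ ∧ δ.length = γ.length + 1}

/-- `T` is pruned if every node has a successor. -/
def IsPruned {α : Type*} (T : Set (List α)) : Prop :=
  ∀ γ ∈ T, (treeSucc T γ).Nonempty

/-- The finite prefix of length `n` of an infinite sequence `p`. -/
def playPrefix {α : Type*} (p : ℕ → α) (n : ℕ) : List α :=
  List.ofFn fun i : Fin n => p i

/-- `[T]`: the infinite sequences all of whose finite prefixes lie in `T`. -/
def Body {α : Type*} (T : Set (List α)) : Set (ℕ → α) :=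
  {p | ∀ n : ℕ, playPrefix p n ∈ T}

/-- `γ[T_γ]`: the elements of `[T]` extending the node `γ`. -/
def cylinder {α : Type*} (T : Set (List α)) (γ : List α) : Set (ℕ → α) :=
  {p | p ∈ Body T ∧ playPrefix p γ.length = γ}

/-- Open subsets of `[T]`: the unions of basic sets `γ[T_γ]`, `γ ∈ T`. -/
def IsOpenIn {α : Type*} (T : Set (List α)) (A : Set (ℕ → α)) : Prop :=
  ∃ S ⊆ T, A = ⋃ γ ∈ S, cylinder T γ

/-- Closed subsets of `[T]`: complements in `[T]` of open subsets of `[T]`. -/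
def IsClosedIn {α : Type*} (T : Set (List α)) (A : Set (ℕ → α)) : Prop :=
  A ⊆ Body T ∧ IsOpenIn T (Body T \ A)

/-- Borel subsets of `[T]`: members of the σ-algebra generated by the open
subsets of `[T]` that are themselves included in `[T]`. -/
def IsBorelIn {α : Type*} (T : Set (List α)) (X : Set (ℕ → α)) : Prop :=
  X ⊆ Body T ∧
    @MeasurableSet (ℕ → α) (MeasurableSpace.generateFrom {A | IsOpenIn T A}) X

/-- `D_θ((A_η)_{η<θ})`: the set of `x ∈ ⋃_{η<θ} A_η` such that the least `η < θ`
with `x ∈ A_η` has parity opposite to that of `θ`. -/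
noncomputable def Dset {α : Type*} (θ : Ordinal.{0}) (A : Ordinal.{0} → Set (ℕ → α)) :
    Set (ℕ → α) :=
  {x | (∃ η < θ, x ∈ A η) ∧ sInf {η | η < θ ∧ x ∈ A η} % 2 ≠ θ % 2}

/-- `D_θ([T])`: all sets of the form `D_θ((A_η)_{η<θ})` for an `⊆`-increasing family
of open subsets of `[T]`. -/
def Dclass {α : Type*} (T : Set (List α)) (θ : Ordinal.{0}) : Set (Set (ℕ → α)) :=
  {X | ∃ A : Ordinal.{0} → Set (ℕ → α),
        (∀ η < θ, IsOpenIn T (A η)) ∧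
        (∀ η₁ η₂, η₁ ≤ η₂ → η₂ < θ → A η₁ ⊆ A η₂) ∧
        X = Dset θ A}

/-- The quasi-difference sets `𝒟([T])`: open sets, unions of quasi-difference sets
placed below pairwise `⊑`-incomparable nodes, and complements in `[T]`. -/
inductive QuasiDiff {α : Type*} (T : Set (List α)) : Set (ℕ → α) → Prop
  | isOpen : ∀ A, IsOpenIn T A → QuasiDiff T A
  | iUnion : ∀ (S : Set (List α)) (D : List α → Set (ℕ → α)),
      S ⊆ T → (S.Pairwise fun γ δ => ¬ γ <+: δ) →
      (∀ γ ∈ S, QuasiDiff T (D γ)) →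
      (∀ γ ∈ S, D γ ⊆ cylinder T γ) →
      QuasiDiff T (⋃ γ ∈ S, D γ)
  | compl : ∀ A, QuasiDiff T A → QuasiDiff T (Body T \ A)

/-- An infinite game in extensive form: a tree `T` of finite plays, an owner function `d`,
an outcome function `v` on infinite plays, and a preference relation for each player. -/
structure Game (α A O : Type*) where
  T : Set (List α)
  d : List α → A
  v : (ℕ → α) → O
  pref : A → O → O → Prop

/-- The infinite sequence starting with `γ` and continuing with `p`. -/
def listExtend {α : Type*} (γ : List α) (p : ℕ → α) : ℕ → α :=
  fun n => if h : n < γ.length then γ.get ⟨n, h⟩ else p (n - γ.length)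

/-- The subgame `g_γ` of `g` at a node `γ`. -/
def Game.sub {α A O : Type*} (g : Game α A O) (γ : List α) : Game α A O where
  T := {δ | γ ++ δ ∈ g.T}
  d := fun δ => g.d (γ ++ δ)
  v := fun p => g.v (listExtend γ p)
  pref := g.pref

/-- A strategy profile on `T`: it maps each node of `T` to a successor. -/
def IsProfile {α : Type*} (T : Set (List α)) (s : List α → List α) : Prop :=
  ∀ γ ∈ T, s γ ∈ treeSucc T γ

/-- The sequence of nodes obtained from `γ` by repeatedly applying `s`. -/
def iterNode {α : Type*} (s : List α → List α) (γ : List α) : ℕ → List α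
  | 0 => γ
  | n + 1 => s (iterNode s γ n)

/-- The play `p^ε(s)` induced by `s` at the root. -/
def inducedPlay {α : Type*} [Inhabited α] (s : List α → List α) : ℕ → α :=
  fun n => (iterNode s [] (n + 1)).getD n default

/-- The subprofile `s_γ`, defined by `γ s_γ(δ) = s(γδ)`. -/
def subProfile {α : Type*} (γ : List α) (s : List α → List α) : List α → List α :=
  fun δ => (s (γ ++ δ)).drop γ.length

/-- `s` is a Nash equilibrium of `g`: no player `a` has a profitable deviation `s'`
differing from `s` only at nodes owned by `a`. -/
def IsNE {α A O : Type*} [Inhabited α] (g : Game α A O) (s : List α → List α) : Prop :=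
  ¬ ∃ (a : A) (s' : List α → List α), IsProfile g.T s' ∧
      (∀ γ ∈ g.T, s γ ≠ s' γ → g.d γ = a) ∧
      g.pref a (g.v (inducedPlay s)) (g.v (inducedPlay s'))

/-- `s` is a subgame perfect equilibrium of `g`: `s_γ` is an NE of `g_γ` for all `γ ∈ T`. -/
def IsSPE {α A O : Type*} [Inhabited α] (g : Game α A O) (s : List α → List α) : Prop :=
  ∀ γ ∈ g.T, IsNE (g.sub γ) (subProfile γ s)

/-- The outcomes occurring in `g`. -/
def OutcomesOf {α A O : Type*} (g : Game α A O) : Set O := g.v '' Body g.T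

/-- `x ∈ Os` is Pareto-optimal in `Os`. -/
def ParetoOpt {A O : Type*} (pref : A → O → O → Prop) (Os : Set O) (x : O) : Prop :=
  x ∈ Os ∧ ∀ y ∈ Os, ∀ a, pref a x y → ∃ b, pref b y x

/-- The outcome induced by the subprofile `s_γ` in the subgame `g_γ`. -/
def subOutcome {α A O : Type*} [Inhabited α] (g : Game α A O) (s : List α → List α)
    (γ : List α) : O :=
  (g.sub γ).v (inducedPlay (subProfile γ s))

/-- Global-Pareto SPE: an SPE inducing in every subgame an outcome that is
Pareto-optimal among the outcomes occurring in that subgame. -/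
def IsGPSPE {α A O : Type*} [Inhabited α] (g : Game α A O) (s : List α → List α) : Prop :=
  IsSPE g s ∧ ∀ γ ∈ g.T, ParetoOpt g.pref (OutcomesOf (g.sub γ)) (subOutcome g s γ)

/-- An `x`-pseudo-leaf: a shortest node `γ ∈ T` such that only `x` occurs in `g_γ`. -/
def IsPseudoLeaf {α A O : Type*} (g : Game α A O) (x : O) (γ : List α) : Prop :=
  γ ∈ g.T ∧ OutcomesOf (g.sub γ) = {x} ∧
    ∀ δ, δ <+: γ → δ ≠ γ → OutcomesOf (g.sub δ) ≠ {x}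

/-- A strict weak order: irreflexive, transitive, with transitive complement. -/
def IsSWO {O : Type*} (r : O → O → Prop) : Prop :=
  (∀ x, ¬ r x x) ∧ (∀ x y z, r x y → r y z → r x z) ∧
  (∀ x y z, ¬ r x y → ¬ r y z → ¬ r x z)

/-- The SPE killer does not occur in the family of preferences `lt`. -/
def NoSPEKiller {A O : Type*} (lt : A → O → O → Prop) : Prop :=
  ∀ a b : A, ∀ x y z : O, ¬ (lt a z y ∧ lt a y x ∧ lt b x z ∧ lt b z y)

/-! Proof. -/

theorem playPrefix_length' {α : Type*} (p : ℕ → α) (n : ℕ) : (playPrefix p n).length = n := by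
  simp [playPrefix]

theorem playPrefix_eq_iff {α : Type*} (p q : ℕ → α) (n : ℕ) :
    playPrefix p n = playPrefix q n ↔ ∀ i < n, p i = q i := by
  unfold playPrefix
  rw [List.ofFn_inj, funext_iff]
  exact ⟨fun h i hi => h ⟨i, hi⟩, fun h i => h i i.2⟩

theorem playPrefix_take {α : Type*} (p : ℕ → α) {m n : ℕ} (h : m ≤ n) :
    (playPrefix p n).take m = playPrefix p m := by
  apply List.ext_getElem
  · simp [playPrefix, h]
  · intro i h1 h2
    simp [playPrefix]

theorem playPrefix_prefix {α : Type*} (p : ℕ → α) {m n : ℕ} (h : m ≤ n) :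
    playPrefix p m <+: playPrefix p n := by
  rw [← playPrefix_take p h]; exact List.take_prefix _ _

theorem mem_cyl {α : Type*} {T : Set (List α)} {x : ℕ → α} (hx : x ∈ Body T) (n : ℕ) :
    x ∈ cylinder T (playPrefix x n) := ⟨hx, by rw [playPrefix_length']⟩

theorem cyl_prefix {α : Type*} {T : Set (List α)} {x : ℕ → α} {γ : List α}
    (h : x ∈ cylinder T γ) {δ : List α} (hd : δ <+: γ) : x ∈ cylinder T δ := by
  refine ⟨h.1, ?_⟩
  rw [← playPrefix_take x hd.length_le, h.2]
  exact (List.prefix_iff_eq_take.1 hd).symm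

theorem cyl_mono {α : Type*} {T : Set (List α)} {γ δ : List α} (hd : δ <+: γ) :
    cylinder T γ ⊆ cylinder T δ := fun _ h => cyl_prefix h hd

theorem cyl_comparable {α : Type*} {T : Set (List α)} {x : ℕ → α} {γ δ : List α}
    (h : x ∈ cylinder T γ) (h' : x ∈ cylinder T δ) : γ <+: δ ∨ δ <+: γ := by
  rcases le_total γ.length δ.length with hl | hl
  · left; rw [← h.2, ← h'.2]; exact playPrefix_prefix x hl
  · right; rw [← h.2, ← h'.2]; exact playPrefix_prefix x hl

theorem isOpenIn_iff {α : Type*} {T : Set (List α)} {A : Set (ℕ → α)} :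
    IsOpenIn T A ↔ A ⊆ Body T ∧ ∀ x ∈ A, ∃ n, cylinder T (playPrefix x n) ⊆ A := by
  constructor
  · rintro ⟨S, hS, rfl⟩
    constructor
    · intro x hx
      simp only [Set.mem_iUnion] at hx
      obtain ⟨γ, _, h⟩ := hx
      exact h.1
    · intro x hx
      simp only [Set.mem_iUnion] at hx
      obtain ⟨γ, hγ, h⟩ := hx
      refine ⟨γ.length, ?_⟩
      rw [h.2]
      exact Set.subset_biUnion_of_mem (u := fun γ => cylinder T γ) hγ
  · rintro ⟨h1, h2⟩
    refine ⟨{γ | γ ∈ T ∧ cylinder T γ ⊆ A}, fun γ h => h.1, ?_⟩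
    apply Set.Subset.antisymm
    · intro x hx
      obtain ⟨n, hn⟩ := h2 x hx
      simp only [Set.mem_iUnion]
      exact ⟨playPrefix x n, ⟨h1 hx n, hn⟩, mem_cyl (h1 hx) n⟩
    · intro x hx
      simp only [Set.mem_iUnion] at hx
      obtain ⟨γ, hγ, h⟩ := hx
      exact hγ.2 h

theorem isOpenIn_cyl {α : Type*} {T : Set (List α)} (γ : List α) : IsOpenIn T (cylinder T γ) :=
  isOpenIn_iff.2 ⟨fun _ h => h.1, fun x h => ⟨γ.length, by rw [h.2]⟩⟩

theorem isOpenIn_body {α : Type*} {T : Set (List α)} : IsOpenIn T (Body T) :=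
  isOpenIn_iff.2 ⟨fun _ h => h, fun _ _ => ⟨0, fun _ h => h.1⟩⟩

theorem isOpenIn_iUnion {α : Type*} {ι : Sort*} {T : Set (List α)} {A : ι → Set (ℕ → α)}
    (h : ∀ i, IsOpenIn T (A i)) : IsOpenIn T (⋃ i, A i) := by
  simp only [isOpenIn_iff] at *
  refine ⟨Set.iUnion_subset fun i => (h i).1, fun x hx => ?_⟩
  obtain ⟨i, hi⟩ := Set.mem_iUnion.1 hx
  obtain ⟨n, hn⟩ := (h i).2 x hi
  exact ⟨n, hn.trans (Set.subset_iUnion _ _)⟩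

theorem isOpenIn_inter {α : Type*} {T : Set (List α)} {A B : Set (ℕ → α)}
    (hA : IsOpenIn T A) (hB : IsOpenIn T B) : IsOpenIn T (A ∩ B) := by
  simp only [isOpenIn_iff] at *
  refine ⟨fun x h => hA.1 h.1, fun x hx => ?_⟩
  obtain ⟨n, hn⟩ := hA.2 x hx.1
  obtain ⟨m, hm⟩ := hB.2 x hx.2
  exact ⟨max n m, Set.subset_inter
    ((cyl_mono (playPrefix_prefix x (le_max_left _ _))).trans hn)
    ((cyl_mono (playPrefix_prefix x (le_max_right _ _))).trans hm)⟩

theorem QuasiDiff.of_local {α : Type*} {T : Set (List α)} {X : Set (ℕ → α)} (hX : X ⊆ Body T)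
    (h : ∀ x ∈ X, ∃ n, QuasiDiff T (X ∩ cylinder T (playPrefix x n))) : QuasiDiff T X := by
  classical
  let S : Set (List α) := {γ | γ ∈ T ∧ QuasiDiff T (X ∩ cylinder T γ) ∧
    ∀ δ, δ <+: γ → QuasiDiff T (X ∩ cylinder T δ) → δ = γ}
  have key : X = ⋃ γ ∈ S, (X ∩ cylinder T γ) := by
    apply Set.Subset.antisymm
    · intro x hx
      have h' := h x hx
      simp only [Set.mem_iUnion]
      refine ⟨playPrefix x (Nat.find h'), ⟨hX hx _, Nat.find_spec h', ?_⟩, hx, mem_cyl (hX hx) _⟩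
      intro δ hδ hq
      have hl := hδ.length_le
      rw [playPrefix_length'] at hl
      have e : δ = playPrefix x δ.length := by
        rw [← playPrefix_take x hl]; exact List.prefix_iff_eq_take.1 hδ
      rw [e] at hq
      have := Nat.find_min' h' hq
      rw [e, le_antisymm hl this]
    · intro x hx
      simp only [Set.mem_iUnion] at hx
      obtain ⟨γ, _, h⟩ := hx
      exact h.1
  rw [key]
  refine QuasiDiff.iUnion S (fun γ => X ∩ cylinder T γ) (fun γ h => h.1) ?_ (fun γ h => h.2.1)
    (fun γ _ => Set.inter_subset_right)
  intro γ hγ δ hδ hne hp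
  exact hne (hδ.2.2 γ hp hγ.2.1)

theorem QuasiDiff.inter_cyl {α : Type*} {T : Set (List α)} {X : Set (ℕ → α)}
    (h : QuasiDiff T X) (γ : List α) : QuasiDiff T (X ∩ cylinder T γ) := by
  induction h with
  | isOpen A hA => exact .isOpen _ (isOpenIn_inter hA (isOpenIn_cyl γ))
  | iUnion S D hS hp hq hD ih =>
    have e : (⋃ δ ∈ S, D δ) ∩ cylinder T γ = ⋃ δ ∈ S, (D δ ∩ cylinder T γ) := by
      simp only [Set.iUnion_inter]
    rw [e]
    exact QuasiDiff.iUnion S (fun δ => D δ ∩ cylinder T γ) hS hp ih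
      (fun δ h => Set.inter_subset_left.trans (hD δ h))
  | compl D hD ih =>
    have e : (Body T \ D) ∩ cylinder T γ =
        Body T \ ((Body T \ cylinder T γ) ∪ (D ∩ cylinder T γ)) := by
      ext x
      have : x ∈ cylinder T γ → x ∈ Body T := fun h => h.1
      simp only [Set.mem_inter_iff, Set.mem_sdiff, Set.mem_union]
      tauto
    rw [e]
    apply QuasiDiff.compl
    have hb : ∀ x, x ∈ cylinder T γ → x ∈ Body T := fun x h => h.1
    apply QuasiDiff.of_local
    · rintro x (h | h)
      · exact h.1
      · exact h.2.1
    · intro x hx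
      refine ⟨γ.length, ?_⟩
      by_cases hc : playPrefix x γ.length = γ
      · rw [hc]
        convert ih using 1
        ext y
        have := hb y
        simp only [Set.mem_inter_iff, Set.mem_sdiff, Set.mem_union]
        tauto
      · apply QuasiDiff.isOpen
        convert isOpenIn_cyl (T := T) (playPrefix x γ.length) using 1
        apply Set.inter_eq_right.2
        intro y hy
        refine Or.inl ⟨hy.1, fun h => hc ?_⟩
        rw [← hy.2, playPrefix_length', h.2]

theorem omod_two (a : Ordinal.{0}) : a % 2 = 0 ∨ a % 2 = 1 := by
  have h : a % 2 < 2 := Ordinal.mod_lt a (by simp)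
  have h2 : a % 2 ≤ 1 := by
    rw [← Order.lt_succ_iff]
    simpa [← one_add_one_eq_two] using h
  rcases h2.lt_or_eq with h | h
  · left; simpa using h
  · right; exact h

theorem omod_succ (a : Ordinal.{0}) : (a % 2 = 0 ∧ (a + 1) % 2 = 1) ∨
    (a % 2 = 1 ∧ (a + 1) % 2 = 0) := by
  have h := Ordinal.div_add_mod a 2
  rcases omod_two a with h0 | h0
  · left
    refine ⟨h0, ?_⟩
    rw [h0, add_zero] at h
    rw [← h, Ordinal.mul_add_mod_self]
    exact Ordinal.mod_eq_of_lt (by simp)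
  · right
    refine ⟨h0, ?_⟩
    rw [h0] at h
    rw [← h, add_assoc, one_add_one_eq_two, Ordinal.mul_add_mod_self, Ordinal.mod_self]

theorem mem_Dset {α : Type*} {θ : Ordinal.{0}} {A : Ordinal.{0} → Set (ℕ → α)} {x : ℕ → α} :
    x ∈ Dset θ A ↔ ∃ r, IsLeast {η | η < θ ∧ x ∈ A η} r ∧ r % 2 ≠ θ % 2 := by
  constructor
  · rintro ⟨h1, h2⟩
    exact ⟨_, ⟨csInf_mem (s := {η | η < θ ∧ x ∈ A η}) h1, fun a ha => csInf_le' ha⟩, h2⟩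
  · rintro ⟨r, h, h2⟩
    exact ⟨⟨r, h.1⟩, by rw [h.csInf_eq]; exact h2⟩

theorem exists_least {s : Set Ordinal.{0}} (h : s.Nonempty) : ∃ r, IsLeast s r :=
  ⟨_, csInf_mem h, fun _ ha => csInf_le' ha⟩

theorem Dclass_sub {α : Type*} {T : Set (List α)} (A : Ordinal.{0} → Set (ℕ → α)) (θ : Ordinal.{0})
    (hA : ∀ η < θ, IsOpenIn T (A η)) (hm : ∀ η₁ η₂, η₁ ≤ η₂ → η₂ < θ → A η₁ ⊆ A η₂) :
    QuasiDiff T (Dset θ A) := by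
  induction θ using Ordinal.induction with
  | h θ ih =>
  have hb : Dset θ A ⊆ Body T := by
    rintro x ⟨⟨η, h1, h2⟩, -⟩
    exact (isOpenIn_iff.1 (hA η h1)).1 h2
  refine QuasiDiff.of_local hb ?_
  rintro x ⟨⟨η, h1, h2⟩, -⟩
  obtain ⟨n, hn⟩ := (isOpenIn_iff.1 (hA η h1)).2 x h2
  refine ⟨n, ?_⟩
  set C := cylinder T (playPrefix x n) with hC
  have ihη := ih η h1 (fun ξ h => hA ξ (h.trans h1)) (fun a b hab hb => hm a b hab (hb.trans h1))
  -- description of membership on the cylinder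
  have desc : ∀ y ∈ C, ∃ r, r ≤ η ∧ IsLeast {ξ | ξ < θ ∧ y ∈ A ξ} r ∧
      (r < η → IsLeast {ξ | ξ < η ∧ y ∈ A ξ} r) ∧ (r = η → ∀ ξ < η, y ∉ A ξ) := by
    intro y hy
    obtain ⟨r, hr⟩ := exists_least (s := {ξ | ξ < θ ∧ y ∈ A ξ}) ⟨η, h1, hn hy⟩
    refine ⟨r, hr.2 ⟨h1, hn hy⟩, hr, fun h => ⟨⟨h, hr.1.2⟩, fun ξ hξ => hr.2 ⟨hξ.1.trans h1, hξ.2⟩⟩,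
      ?_⟩
    rintro rfl ξ hξ hy'
    exact absurd (hr.2 ⟨hξ.trans h1, hy'⟩) (not_le.2 hξ)
  by_cases hp : η % 2 = θ % 2
  · convert ihη.inter_cyl (playPrefix x n) using 1
    ext y
    refine and_congr_left fun hy => ?_
    obtain ⟨r, hrle, hr, ha, hb⟩ := desc y hy
    rw [mem_Dset, mem_Dset]
    constructor
    · rintro ⟨r', hr', hpar⟩
      obtain rfl := hr.unique hr'
      rcases hrle.lt_or_eq with h | h
      · exact ⟨r, ha h, hp ▸ hpar⟩
      · exact absurd (h ▸ hp) hpar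
    · rintro ⟨r', hr', hpar⟩
      rcases hrle.lt_or_eq with h | h
      · obtain rfl := (ha h).unique hr'
        exact ⟨r, hr, hp ▸ hpar⟩
      · exact absurd hr'.1.2 (hb h _ hr'.1.1)
  · convert (QuasiDiff.compl _ ihη).inter_cyl (playPrefix x n) using 1
    ext y
    refine and_congr_left fun hy => ?_
    obtain ⟨r, hrle, hr, ha, hb⟩ := desc y hy
    rw [Set.mem_sdiff, mem_Dset, mem_Dset]
    constructor
    · rintro ⟨r', hr', hpar⟩
      obtain rfl := hr.unique hr'
      refine ⟨hy.1, ?_⟩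
      rintro ⟨r'', hr'', hpar'⟩
      rcases hrle.lt_or_eq with h | h
      · obtain rfl := (ha h).unique hr''
        rcases omod_two r with e | e <;> rcases omod_two η with e' | e' <;>
          rcases omod_two θ with e'' | e'' <;> simp_all
      · exact absurd hr''.1.2 (hb h _ hr''.1.1)
    · rintro ⟨-, hno⟩
      refine ⟨r, hr, ?_⟩
      rcases hrle.lt_or_eq with h | h
      · intro e
        exact hno ⟨r, ha h, fun e' => hp (e'.symm.trans e)⟩
      · rw [h]; exact hp

/-- Normalized form of the difference classes. -/
def DNormal {α : Type*} (T : Set (List α)) (X : Set (ℕ → α)) (θ : Ordinal.{0}) : Prop :=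
  ∃ B : Ordinal.{0} → Set (ℕ → α), (∀ η, IsOpenIn T (B η)) ∧ Monotone B ∧
    (∀ η, B η ⊆ B θ) ∧ ∀ x, x ∈ X ↔ ∃ r, IsLeast {η | x ∈ B η} r ∧ r % 2 = 1

theorem normal_of_Dclass {α : Type*} {T : Set (List α)} {X : Set (ℕ → α)} {θ : Ordinal.{0}}
    (h : X ∈ Dclass T θ) : DNormal T X θ := by
  obtain ⟨A, hA, hm, rfl⟩ := h
  rcases omod_two θ with hp | hp
  · refine ⟨fun η => ⋃ ξ : {ξ // ξ < θ ∧ ξ ≤ η}, A ξ, fun η => isOpenIn_iUnion fun ξ => hA _ ξ.2.1,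
      ?_, ?_, ?_⟩
    · intro a b hab x hx
      obtain ⟨⟨ξ, h1, h2⟩, h3⟩ := Set.mem_iUnion.1 hx
      exact Set.mem_iUnion.2 ⟨⟨ξ, h1, h2.trans hab⟩, h3⟩
    · intro a x hx
      obtain ⟨⟨ξ, h1, h2⟩, h3⟩ := Set.mem_iUnion.1 hx
      exact Set.mem_iUnion.2 ⟨⟨ξ, h1, h1.le⟩, h3⟩
    · intro x
      rw [mem_Dset]
      refine exists_congr fun r => ?_
      have : IsLeast {η | η < θ ∧ x ∈ A η} r ↔
          IsLeast {η | x ∈ ⋃ ξ : {ξ // ξ < θ ∧ ξ ≤ η}, A ξ} r := by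
        constructor
        · rintro ⟨h1, h2⟩
          refine ⟨Set.mem_iUnion.2 ⟨⟨r, h1.1, le_rfl⟩, h1.2⟩, fun η hη => ?_⟩
          obtain ⟨⟨ξ, h3, h4⟩, h5⟩ := Set.mem_iUnion.1 hη
          exact (h2 ⟨h3, h5⟩).trans h4
        · rintro ⟨h1, h2⟩
          obtain ⟨⟨ξ, h3, h4⟩, h5⟩ := Set.mem_iUnion.1 h1
          have : r ≤ ξ := h2 (Set.mem_iUnion.2 ⟨⟨ξ, h3, le_rfl⟩, h5⟩)
          obtain rfl := le_antisymm h4 this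
          exact ⟨⟨h3, h5⟩, fun η hη => h2 (Set.mem_iUnion.2 ⟨⟨η, hη.1, le_rfl⟩, hη.2⟩)⟩
      rw [this]
      refine and_congr_right fun _ => ?_
      rcases omod_two r with e | e <;> simp [e, hp]
  · refine ⟨fun η => ⋃ ξ : {ξ // ξ < θ ∧ ξ < η}, A ξ, fun η => isOpenIn_iUnion fun ξ => hA _ ξ.2.1,
      ?_, ?_, ?_⟩
    · intro a b hab x hx
      obtain ⟨⟨ξ, h1, h2⟩, h3⟩ := Set.mem_iUnion.1 hx
      exact Set.mem_iUnion.2 ⟨⟨ξ, h1, h2.trans_le hab⟩, h3⟩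
    · intro a x hx
      obtain ⟨⟨ξ, h1, h2⟩, h3⟩ := Set.mem_iUnion.1 hx
      exact Set.mem_iUnion.2 ⟨⟨ξ, h1, h1⟩, h3⟩
    · intro x
      rw [mem_Dset]
      have key : ∀ r, IsLeast {η | η < θ ∧ x ∈ A η} r →
          IsLeast {η | x ∈ ⋃ ξ : {ξ // ξ < θ ∧ ξ < η}, A ξ} (r + 1) := by
        rintro r ⟨h1, h2⟩
        refine ⟨Set.mem_iUnion.2 ⟨⟨r, h1.1, Order.lt_add_one_iff.2 le_rfl⟩, h1.2⟩, fun η hη => ?_⟩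
        obtain ⟨⟨ξ, h3, h4⟩, h5⟩ := Set.mem_iUnion.1 hη
        exact Order.add_one_le_of_lt ((h2 ⟨h3, h5⟩).trans_lt h4)
      constructor
      · rintro ⟨r, h, hr⟩
        refine ⟨r + 1, key r h, ?_⟩
        rcases omod_succ r with e | e <;> simp_all
      · rintro ⟨r, h, hr⟩
        obtain ⟨⟨ξ, h3, h4⟩, h5⟩ := Set.mem_iUnion.1 h.1
        obtain ⟨s, hs⟩ := exists_least (s := {η | η < θ ∧ x ∈ A η}) ⟨ξ, h3, h5⟩
        obtain rfl := h.unique (key s hs)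
        refine ⟨s, hs, ?_⟩
        rcases omod_succ s with e | e <;> simp_all

theorem Dclass_of_normal {α : Type*} {T : Set (List α)} {X : Set (ℕ → α)} {θ : Ordinal.{0}}
    (h : DNormal T X θ) : X ∈ Dclass T (2 * (θ + 1)) := by
  obtain ⟨B, hB, hm, hs, hX⟩ := h
  refine ⟨B, fun η _ => hB η, fun a b hab _ => hm hab, ?_⟩
  have hlt : θ < 2 * (θ + 1) :=
    (Order.lt_add_one_iff.2 le_rfl).trans_le (Ordinal.le_mul_right _ (by simp))
  ext x
  rw [hX, mem_Dset]
  refine exists_congr fun r => ?_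
  rw [Ordinal.mul_mod]
  refine and_congr ⟨?_, ?_⟩ (by rcases omod_two r with e | e <;> simp [e])
  · rintro ⟨h1, h2⟩
    exact ⟨⟨(h2 (hs r h1)).trans_lt hlt, h1⟩, fun η hη => h2 hη.2⟩
  · rintro ⟨h1, h2⟩
    refine ⟨h1.2, fun η hη => ?_⟩
    rcases lt_or_ge η (2 * (θ + 1)) with h | h
    · exact h2 ⟨h, hη⟩
    · exact h1.1.le.trans h

theorem normal_mono {α : Type*} {T : Set (List α)} {X : Set (ℕ → α)} {θ θ' : Ordinal.{0}}
    (h : DNormal T X θ) (hle : θ ≤ θ') : DNormal T X θ' := by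
  obtain ⟨B, hB, hm, hs, hX⟩ := h
  exact ⟨B, hB, hm, fun η => (hs η).trans (hm hle), hX⟩

theorem normal_iUnion {α : Type*} {T : Set (List α)} {θ : Ordinal.{0}} (S : Set (List α))
    (D : List α → Set (ℕ → α)) (hp : S.Pairwise fun γ δ => ¬ γ <+: δ)
    (h : ∀ γ ∈ S, DNormal T (D γ) θ) (hD : ∀ γ ∈ S, D γ ⊆ cylinder T γ) :
    DNormal T (⋃ γ ∈ S, D γ) θ := by
  have h' : ∀ γ : S, DNormal T (D γ) θ := fun γ => h γ γ.2
  choose B hB hm hs hX using h'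
  have mem : ∀ η x, x ∈ (⋃ γ : S, (B γ η ∩ cylinder T γ)) ↔
      ∃ γ : S, x ∈ B γ η ∧ x ∈ cylinder T γ := by
    intro η x; simp only [Set.mem_iUnion, Set.mem_inter_iff]
  have uniq : ∀ γ δ : S, ∀ x, x ∈ cylinder T γ → x ∈ cylinder T δ → γ = δ := by
    intro γ δ x h1 h2
    by_contra hne
    have hne' : (γ : List α) ≠ δ := fun e => hne (Subtype.ext e)
    rcases cyl_comparable h1 h2 with h | h
    · exact hp γ.2 δ.2 hne' h
    · exact hp δ.2 γ.2 hne'.symm h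
  refine ⟨fun η => ⋃ γ : S, (B γ η ∩ cylinder T γ),
    fun η => isOpenIn_iUnion fun γ => isOpenIn_inter (hB γ η) (isOpenIn_cyl _), ?_, ?_, ?_⟩
  · intro a b hab x hx
    obtain ⟨γ, h1, h2⟩ := (mem _ _).1 hx
    exact (mem _ _).2 ⟨γ, hm γ hab h1, h2⟩
  · intro a x hx
    obtain ⟨γ, h1, h2⟩ := (mem _ _).1 hx
    exact (mem _ _).2 ⟨γ, hs γ a h1, h2⟩
  · intro x
    have loc : ∀ γ : S, x ∈ cylinder T γ →
        {η | x ∈ ⋃ γ : S, (B γ η ∩ cylinder T γ)} = {η | x ∈ B γ η} := by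
      intro γ hγ
      ext η
      rw [Set.mem_setOf_eq, mem]
      constructor
      · rintro ⟨δ, h1, h2⟩
        obtain rfl := uniq γ δ x hγ h2
        exact h1
      · intro h
        exact ⟨γ, h, hγ⟩
    constructor
    · intro hx
      simp only [Set.mem_iUnion] at hx
      obtain ⟨γ, hγ, hxγ⟩ := hx
      obtain ⟨r, h1, h2⟩ := (hX ⟨γ, hγ⟩ x).1 hxγ
      refine ⟨r, ?_, h2⟩
      rw [loc ⟨γ, hγ⟩ (hD γ hγ hxγ)]
      exact h1
    · rintro ⟨r, h1, h2⟩
      obtain ⟨γ, h3, h4⟩ := (mem _ _).1 h1.1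
      rw [loc γ h4] at h1
      simp only [Set.mem_iUnion]
      exact ⟨γ, γ.2, (hX γ x).2 ⟨r, h1, h2⟩⟩

theorem Dclass_compl {α : Type*} {T : Set (List α)} {X : Set (ℕ → α)} {θ : Ordinal.{0}}
    (h : X ∈ Dclass T θ) : Body T \ X ∈ Dclass T (θ + 1) := by
  classical
  obtain ⟨A, hA, hm, rfl⟩ := h
  have hlt : ∀ η, η < θ + 1 ↔ η ≤ θ := fun η => Order.lt_add_one_iff
  refine ⟨fun η => if η < θ then A η else Body T, ?_, ?_, ?_⟩
  · intro η _
    dsimp only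
    split_ifs with h
    · exact hA η h
    · exact isOpenIn_body
  · intro a b hab hb
    dsimp only
    split_ifs with h1 h2 h2
    · exact hm a b hab h2
    · exact (isOpenIn_iff.1 (hA a h1)).1
    · exact absurd (hab.trans_lt h2) h1
    · exact le_rfl
  · ext x
    rw [Set.mem_sdiff, mem_Dset, mem_Dset]
    by_cases hx : ∃ η < θ, x ∈ A η
    · obtain ⟨r, hr⟩ := exists_least (s := {η | η < θ ∧ x ∈ A η}) hx
      have hr' : IsLeast {η | η < θ + 1 ∧ x ∈ if η < θ then A η else Body T} r := by
        refine ⟨⟨(hlt r).2 hr.1.1.le, by rw [if_pos hr.1.1]; exact hr.1.2⟩, fun η hη => ?_⟩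
        by_cases h : η < θ
        · have := hη.2
          rw [if_pos h] at this
          exact hr.2 ⟨h, this⟩
        · exact hr.1.1.le.trans (not_lt.1 h)
      have hxb : x ∈ Body T := (isOpenIn_iff.1 (hA r hr.1.1)).1 hr.1.2
      constructor
      · rintro ⟨-, h⟩
        refine ⟨r, hr', ?_⟩
        have : r % 2 = θ % 2 := by
          by_contra hne
          exact h ⟨r, hr, hne⟩
        rcases omod_succ θ with e | e <;> simp [this, e]
      · rintro ⟨s, hs, hpar⟩
        obtain rfl := hr'.unique hs
        refine ⟨hxb, ?_⟩
        rintro ⟨s, hs, hpar'⟩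
        obtain rfl := hr.unique hs
        rcases omod_succ θ with e | e <;> rcases omod_two r with e' | e' <;> simp_all
    · push Not at hx
      constructor
      · rintro ⟨hb, -⟩
        refine ⟨θ, ⟨⟨(hlt θ).2 le_rfl, by rw [if_neg (lt_irrefl _)]; exact hb⟩, fun η hη => ?_⟩, ?_⟩
        · by_contra h
          have := hη.2
          rw [if_pos (not_le.1 h)] at this
          exact hx η (not_le.1 h) this
        · rcases omod_succ θ with e | e <;> simp [e]
      · rintro ⟨r, hr, -⟩
        have h := hr.1.2
        split_ifs at h with h1
        · exact absurd h (hx r h1)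
        · refine ⟨h, ?_⟩
          rintro ⟨s, hs, -⟩
          exact hx s hs.1.1 hs.1.2

theorem Dclass_open {α : Type*} {T : Set (List α)} {X : Set (ℕ → α)}
    (h : IsOpenIn T X) : X ∈ Dclass T 1 := by
  refine ⟨fun _ => X, fun _ _ => h, fun _ _ _ _ => le_rfl, ?_⟩
  ext x
  rw [mem_Dset]
  have h1 : (1 : Ordinal.{0}) % 2 = 1 := Ordinal.mod_eq_of_lt (by simp)
  constructor
  · intro hx
    refine ⟨0, ⟨⟨by simp, hx⟩, fun _ _ => by simp⟩, ?_⟩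
    rw [h1]; simp
  · rintro ⟨r, hr, -⟩
    exact hr.1.2

/-- for a countable pruned tree `T`,
`𝒟([T]) = ⋃_{0 < θ < ω₁} D_θ([T])`. -/
theorem stmt3 {α : Type*} (T : Set (List α)) (hT : IsTree T) (hpr : IsPruned T)
    (hTc : T.Countable) (X : Set (ℕ → α)) :
    QuasiDiff T X ↔
      ∃ θ : Ordinal.{0}, θ ≠ 0 ∧ θ.card ≤ Cardinal.aleph0 ∧ X ∈ Dclass T θ := by
  constructor
  · intro h
    induction h with
    | isOpen A hA => exact ⟨1, by simp, by simp, Dclass_open hA⟩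
    | iUnion S D hS hp hq hD ih =>
      have hSc : Countable S := (hTc.mono hS).to_subtype
      choose θ h0 hc hX using fun γ : S => ih γ γ.2
      obtain ⟨Θ, hΘ, hΘc⟩ : ∃ Θ : Ordinal.{0}, (∀ γ, θ γ ≤ Θ) ∧ Θ.card ≤ Cardinal.aleph0 := by
        have : Small.{0} S := inferInstance
        refine ⟨⨆ γ, θ γ, fun γ => Ordinal.le_iSup θ γ, ?_⟩
        exact Ordinal.card_iSup_le_lift (by simp) hc
      refine ⟨2 * (Θ + 1), by simp, ?_, Dclass_of_normal (normal_iUnion S D hp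
        (fun γ hγ => normal_mono (normal_of_Dclass (hX ⟨γ, hγ⟩)) (hΘ _)) hD)⟩
      rw [Ordinal.card_mul, Ordinal.card_add]
      rw [← Cardinal.aleph0_mul_aleph0]
      refine mul_le_mul' ?_ (Cardinal.add_le_aleph0.2 ⟨hΘc, by simp⟩)
      have h2 : (2 : Ordinal.{0}).card = 2 := Ordinal.card_ofNat 2
      rw [h2]
      exact_mod_cast (Cardinal.natCast_lt_aleph0 (n := 2)).le
    | compl A hA ih =>
      obtain ⟨θ, h0, hc, hX⟩ := ih
      refine ⟨θ + 1, by simp, ?_, Dclass_compl hX⟩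
      rw [Ordinal.card_add]
      exact Cardinal.add_le_aleph0.2 ⟨hc, by simp⟩
  · rintro ⟨θ, -, -, A, hA, hm, rfl⟩
    exact Dclass_sub A θ hA hm
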